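/- (Doubly bounded first Rogers–Ramanujan identity) For all integers L, M ≥ 0: Σ_{j∈ℤ} (-1)^j q^{j(5j+1)/2} S(L, M, ⌊(5j+1)/2⌋, 2j) = Σ_{n=0}^M q^{n²} [L+M-n choose L][L-n choose n]. -/

import Mathlib

open Finset

noncomputable section

/-- The field of rational functions over ℚ in which the identities are stated. -/
abbrev K : Type := RatFunc ℚ

/-- The variable. -/
def tq : K := RatFunc.X

/-- Gaussian binomial coefficient `[n choose k]` in the variable `p`:
`∏_{j=1}^{k} (1 - p^(n-k+j))/(1 - p^j)` when `0 ≤ k ≤ n`, and `0` otherwise. -/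
def gb (p : K) (n k : ℤ) : K :=
  if 0 ≤ k ∧ k ≤ n then
    ∏ j ∈ Finset.range k.toNat, (1 - p ^ (n - k + 1 + (j : ℤ))) / (1 - p ^ (1 + (j : ℤ)))
  else 0

/-- The refined q-trinomial
`S(L,M,a,b) = Σ_{k=0}^L p^{k(k+a)} [L+M-a-2k choose M][M-a+b choose k][M+a-b choose k+a]`. -/
def Sr (p : K) (L M a b : ℤ) : K :=
  ∑ k ∈ Finset.range (L.toNat + 1),
    p ^ ((k : ℤ) * ((k : ℤ) + a)) * gb p (L + M - a - 2 * k) M * gb p (M - a + b) k *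
      gb p (M + a - b) ((k : ℤ) + a)

section GaussianBinomial

variable {F : Type*} [Field F] {q : F}

/-- Gaussian binomial coefficient with arbitrary integer top, as a polynomial in `q ^ n`. -/
def qbinom (q : F) (n k : ℤ) : F :=
  if 0 ≤ k then ∏ j ∈ range k.toNat, (1 - q ^ (n - (j : ℤ))) / (1 - q ^ (1 + (j : ℤ))) else 0

theorem qbinom_of_neg (n : ℤ) {k : ℤ} (hk : k < 0) : qbinom q n k = 0 :=
  if_neg (not_le.2 hk)

@[simp]
theorem qbinom_zero_right (n : ℤ) : qbinom q n 0 = 1 := by simp [qbinom]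

theorem qbinom_eq_zero {n k : ℤ} (hn : 0 ≤ n) (hk : n < k) : qbinom q n k = 0 := by
  rw [qbinom, if_pos (by omega)]
  refine prod_eq_zero (i := n.toNat) (by simp; omega) ?_
  simp [Int.toNat_of_nonneg hn]

theorem one_sub_zpow_ne_zero (hq : ∀ k : ℤ, k ≠ 0 → q ^ k ≠ 1) {k : ℤ} (hk : k ≠ 0) :
    1 - q ^ k ≠ 0 :=
  sub_ne_zero.2 (hq k hk).symm

theorem qbinom_succ_right (hq : ∀ k : ℤ, k ≠ 0 → q ^ k ≠ 1) (n k : ℤ) :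
    (1 - q ^ (k + 1)) * qbinom q n (k + 1) = (1 - q ^ (n - k)) * qbinom q n k := by
  rcases lt_trichotomy k (-1) with hk | rfl | hk
  · simp [qbinom_of_neg n (by omega : k < 0),
      qbinom_of_neg n (by omega : k + 1 < 0)]
  · simp [qbinom_of_neg n (by omega : (-1 : ℤ) < 0)]
  · lift k to ℕ using by omega
    have h := one_sub_zpow_ne_zero hq (by omega : 1 + (k : ℤ) ≠ 0)
    rw [qbinom, qbinom, if_pos (by omega), if_pos (by omega),
      show ((k : ℤ) + 1).toNat = k + 1 by omega, Int.toNat_natCast, prod_range_succ,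
      add_comm (k : ℤ) 1]
    field_simp

theorem qbinom_succ_succ_mul (hq : ∀ k : ℤ, k ≠ 0 → q ^ k ≠ 1) (n k : ℤ) :
    (1 - q ^ (k + 1)) * qbinom q (n + 1) (k + 1) = (1 - q ^ (n + 1)) * qbinom q n k := by
  rcases lt_trichotomy k (-1) with hk | rfl | hk
  · simp [qbinom_of_neg n (by omega : k < 0), qbinom_of_neg (n + 1) (by omega : k + 1 < 0)]
  · simp [qbinom_of_neg n (by omega : (-1 : ℤ) < 0)]
  · lift k to ℕ using by omega
    induction k with
    | zero =>
      have h := one_sub_zpow_ne_zero hq one_ne_zero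
      simp only [qbinom]
      simp at h ⊢
      field_simp
    | succ k ih =>
      have h1 := qbinom_succ_right hq (n + 1) (k + 1)
      have h2 := qbinom_succ_right hq n k
      have h := one_sub_zpow_ne_zero hq (by omega : (k : ℤ) + 1 ≠ 0)
      have ih := ih (by omega)
      push_cast
      apply mul_left_cancel₀ h
      rw [h1, mul_left_comm, mul_left_comm _ (1 - q ^ (n + 1)), h2, ih,
        show n + 1 - ((k : ℤ) + 1) = n - k by ring]
      ring

theorem qbinom_succ_left (h0 : q ≠ 0) (hq : ∀ k : ℤ, k ≠ 0 → q ^ k ≠ 1) (n k : ℤ) :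
    qbinom q (n + 1) k = qbinom q n k + q ^ (n + 1 - k) * qbinom q n (k - 1) := by
  rcases eq_or_ne k 0 with rfl | hk
  · simp [qbinom_of_neg n (by omega : (-1 : ℤ) < 0)]
  · have h1 := qbinom_succ_succ_mul hq n (k - 1)
    have h2 := qbinom_succ_right hq n (k - 1)
    rw [sub_add_cancel] at h1 h2
    have h3 : q ^ (n + 1) = q ^ (n + 1 - k) * q ^ k := by rw [← zpow_add₀ h0]; congr 1; ring
    apply mul_left_cancel₀ (one_sub_zpow_ne_zero hq hk)
    rw [show n - (k - 1) = n + 1 - k by ring] at h2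
    rw [h1, mul_add, h2, h3]
    ring

theorem qbinom_succ_left' (h0 : q ≠ 0) (hq : ∀ k : ℤ, k ≠ 0 → q ^ k ≠ 1) (n k : ℤ) :
    qbinom q (n + 1) k = qbinom q n (k - 1) + q ^ k * qbinom q n k := by
  have h2 := qbinom_succ_right hq n (k - 1)
  rw [sub_add_cancel, show n - (k - 1) = n + 1 - k by ring] at h2
  rw [qbinom_succ_left h0 hq]
  linear_combination h2

theorem qbinom_symm (h0 : q ≠ 0) (hq : ∀ k : ℤ, k ≠ 0 → q ^ k ≠ 1) {n : ℤ} (hn : 0 ≤ n)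
    (k : ℤ) : qbinom q n k = qbinom q n (n - k) := by
  lift n to ℕ using hn
  induction n generalizing k with
  | zero =>
    rcases lt_trichotomy k 0 with hk | rfl | hk
    · rw [qbinom_of_neg _ hk, qbinom_eq_zero (by simp) (by push_cast; omega)]
    · simp
    · rw [qbinom_eq_zero (by simp) (by simpa), qbinom_of_neg _ (by push_cast; omega)]
  | succ n ih =>
    push_cast
    rw [qbinom_succ_left h0 hq, qbinom_succ_left' h0 hq, ih k, ih (k - 1)]
    ring_nf

theorem qbinom_neg (h0 : q ≠ 0) (hq : ∀ k : ℤ, k ≠ 0 → q ^ k ≠ 1) (n k : ℤ) :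
    qbinom q (-n) k =
      (-1) ^ k * q ^ (-(n * k) - k * (k - 1) / 2) * qbinom q (n + k - 1) k := by
  rcases lt_or_ge k 0 with hk | hk
  · simp [qbinom_of_neg _ hk]
  lift k to ℕ using hk
  induction k with
  | zero => simp
  | succ k ih =>
    push_cast
    have h1 := qbinom_succ_right hq (-n) k
    have h2 := qbinom_succ_succ_mul hq (n + k - 1) k
    rw [show n + (k : ℤ) - 1 + 1 = n + (k + 1) - 1 by ring] at h2
    have h := one_sub_zpow_ne_zero hq (by omega : (k : ℤ) + 1 ≠ 0)
    apply mul_left_cancel₀ h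
    obtain ⟨c, hc⟩ := Int.even_mul_pred_self (k : ℤ)
    rw [h1, ih, mul_left_comm (1 - q ^ ((k : ℤ) + 1)), h2, zpow_add_one₀ (by simp),
      show (k : ℤ) * (k - 1) / 2 = c by omega,
      show ((k : ℤ) + 1) * (k + 1 - 1) / 2 = c + k by
        rw [show ((k : ℤ) + 1) * (k + 1 - 1) = (k * (k - 1)) + k * 2 by ring]; omega,
      show -(n * ((k : ℤ) + 1)) - (c + k) = -(n * k) - c + (-n - k) by ring, zpow_add₀ h0]
    have h3 : q ^ (n + ((k : ℤ) + 1) - 1) = (q ^ (-n - (k : ℤ)))⁻¹ := by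
      rw [← zpow_neg]; congr 1; ring
    have h4 := zpow_ne_zero (-n - (k : ℤ)) h0
    rw [h3]
    field_simp
    ring

/-- The coefficients in the expansion `qbinom_mul_qbinom`. -/
def gouldCoeff (q : F) (d m n k : ℤ) : F :=
  q ^ ((n - k) * (m + d - k)) * qbinom q (m + d) k * qbinom q (n - d) (n - k)

theorem gouldCoeff_succ (h0 : q ≠ 0) (hq : ∀ k : ℤ, k ≠ 0 → q ^ k ≠ 1) (d m n k : ℤ) :
    (1 - q ^ (n + 1)) * gouldCoeff q d m (n + 1) k =
      q ^ (m + d - k) * (1 - q ^ (k + 1 + n - d)) * gouldCoeff q d m n k +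
        (1 - q ^ (m + d - k + 1)) * gouldCoeff q d m n (k - 1) := by
  have h1 := qbinom_succ_right hq (m + d) (k - 1)
  rw [sub_add_cancel, show m + d - (k - 1) = m + d - k + 1 by ring] at h1
  have h2 := qbinom_succ_left' h0 hq (n - d) (n + 1 - k)
  rw [show n + 1 - k - 1 = n - k by ring, show n - d + 1 = n + 1 - d by ring] at h2
  have h3 := qbinom_succ_right hq (n - d) (n - k)
  rw [show n - k + 1 = n + 1 - k by ring, show n - d - (n - k) = k - d by ring] at h3
  have e1 : q ^ ((n + 1 - k) * (m + d - k)) = q ^ ((n - k) * (m + d - k)) * q ^ (m + d - k) := by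
    rw [← zpow_add₀ h0]; congr 1; ring
  have e2 : q ^ ((n - (k - 1)) * (m + d - (k - 1))) =
      q ^ ((n - k) * (m + d - k)) * q ^ (m + d - k) * q ^ (n + 1 - k) := by
    rw [← zpow_add₀ h0, ← zpow_add₀ h0]; congr 1; ring
  have e3 : q ^ (k + 1 + n - d) = q ^ (n + 1) * q ^ (k - d) := by
    rw [← zpow_add₀ h0]; congr 1; ring
  have e4 : q ^ (n + 1) = q ^ (n + 1 - k) * q ^ k := by
    rw [← zpow_add₀ h0]; congr 1; ring
  simp only [gouldCoeff]
  rw [show n - (k - 1) = n + 1 - k by ring] at e2 ⊢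
  rw [e1, e2, e3, h2]
  linear_combination
    (-q ^ ((n - k) * (m + d - k)) * q ^ (m + d - k) * q ^ (n + 1 - k) *
      qbinom q (n - d) (n + 1 - k)) * (-h1) -
    q ^ ((n - k) * (m + d - k)) * q ^ (m + d - k) * qbinom q (m + d) k * q ^ (n + 1) * (-h3) -
    q ^ ((n - k) * (m + d - k)) * q ^ (m + d - k) * qbinom q (m + d) k *
      qbinom q (n - d) (n + 1 - k) * e4

theorem qbinom_mul_qbinom (h0 : q ≠ 0) (hq : ∀ k : ℤ, k ≠ 0 → q ^ k ≠ 1) (x d : ℤ) {m : ℤ}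
    (hm : 0 ≤ m) (n : ℕ) :
    qbinom q x m * qbinom q (x + d) n =
      ∑ k ∈ range (n + 1), gouldCoeff q d m n k * qbinom q (x + k) (m + n) := by
  induction n with
  | zero => simp [gouldCoeff]
  | succ n ih =>
    have hn := one_sub_zpow_ne_zero hq (by omega : (n : ℤ) + 1 ≠ 0)
    have hmn := one_sub_zpow_ne_zero hq (by omega : m + n + 1 ≠ 0)
    apply mul_left_cancel₀ (mul_ne_zero hn hmn)
    have key : ∀ k : ℤ, (1 - q ^ (m + n + 1)) * (1 - q ^ (x + d - n)) * qbinom q (x + k) (m + n) =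
        (1 - q ^ (m + n + 1)) *
          (q ^ (m + d - k) * (1 - q ^ (k + 1 + n - d)) * qbinom q (x + k) (m + n + 1) +
            (1 - q ^ (m + d - k)) * qbinom q (x + (k + 1)) (m + n + 1)) := by
      intro k
      have h1 := qbinom_succ_right hq (x + k) (m + n)
      have h2 := qbinom_succ_succ_mul hq (x + k) (m + n)
      rw [add_assoc x] at h2
      have e1 : q ^ (x + k - (m + n)) = q ^ x * q ^ k / (q ^ m * q ^ n) := by
        rw [zpow_sub₀ h0, zpow_add₀ h0 x, zpow_add₀ h0 m, zpow_natCast]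
      have e2 : q ^ (m + d - k) = q ^ m * q ^ d / q ^ k := by
        rw [← zpow_add₀ h0, ← zpow_sub₀ h0]
      have e3 : q ^ (k + 1 + n - d) = q ^ k * q * q ^ n / q ^ d := by
        rw [zpow_sub₀ h0, zpow_add₀ h0, zpow_add₀ h0, zpow_one, zpow_natCast]
      have e4 : q ^ (x + d - n) = q ^ x * q ^ d / q ^ n := by
        rw [zpow_sub₀ h0, zpow_add₀ h0, zpow_natCast]
      have e5 : q ^ (m + n + 1) = q ^ m * q ^ n * q := by
        rw [zpow_add₀ h0, zpow_add₀ h0, zpow_one, zpow_natCast]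
      have e6 : q ^ (x + (k + 1)) = q ^ x * q ^ k * q := by
        rw [zpow_add₀ h0, zpow_add₀ h0, zpow_one, mul_assoc]
      rw [e6] at h2
      have hm0 := zpow_ne_zero m h0
      have hk0 := zpow_ne_zero k h0
      have hd0 := zpow_ne_zero d h0
      have hn0 := pow_ne_zero n h0
      calc _ = q ^ (m + d - k) * (1 - q ^ (k + 1 + n - d)) *
              ((1 - q ^ (x + k - (m + n))) * qbinom q (x + k) (m + n)) +
            (1 - q ^ (m + d - k)) * ((1 - q ^ x * q ^ k * q) * qbinom q (x + k) (m + n)) := by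
              rw [e1, e2, e3, e4, e5]
              field_simp
              ring
        _ = _ := by rw [← h1, ← h2]; ring
    have hs := qbinom_succ_right hq (x + d) n
    calc _ = (1 - q ^ (m + n + 1)) * (1 - q ^ (x + d - n)) *
          (qbinom q x m * qbinom q (x + d) n) := by
            push_cast
            linear_combination (1 - q ^ (m + n + 1)) * qbinom q x m * hs
      _ = (1 - q ^ (m + n + 1)) * (∑ k ∈ range (n + 1),
            q ^ (m + d - k) * (1 - q ^ (k + 1 + n - d)) * gouldCoeff q d m n k *
              qbinom q (x + k) (m + n + 1) + ∑ k ∈ range (n + 1),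
            (1 - q ^ (m + d - k)) * gouldCoeff q d m n k *
              qbinom q (x + (k + 1)) (m + n + 1)) := by
            rw [ih, ← sum_add_distrib, mul_sum, mul_sum]
            refine sum_congr rfl fun k _ => ?_
            linear_combination gouldCoeff q d m n k * key k
      _ = (1 - q ^ (m + n + 1)) * ∑ k ∈ range (n + 1 + 1),
            (1 - q ^ ((n : ℤ) + 1)) * gouldCoeff q d m (n + 1) k *
              qbinom q (x + k) (m + n + 1) := by
            simp only [gouldCoeff_succ h0 hq, add_mul, sum_add_distrib]
            congr 2
            · rw [sum_range_succ _ (n + 1)]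
              simp [gouldCoeff, qbinom_of_neg _ (by omega : (-1 : ℤ) < 0)]
            · rw [sum_range_succ' _ (n + 1)]
              simp only [gouldCoeff, Nat.cast_zero, zero_sub,
                qbinom_of_neg _ (by omega : (-1 : ℤ) < 0)]
              simp only [mul_zero, zero_mul, add_zero]
              refine sum_congr rfl fun k _ => ?_
              push_cast
              rw [add_sub_cancel_right, show m + d - ((k : ℤ) + 1) + 1 = m + d - k by ring]
      _ = _ := by
            rw [mul_sum, mul_sum]
            refine sum_congr rfl fun k _ => ?_
            push_cast
            rw [← add_assoc m]
            ring

end GaussianBinomial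

theorem sum_range_comp_equiv {A : Type*} [AddCommMonoid A] (e : ℤ ≃ ℤ) (f : ℤ → A) (a b : ℕ)
    (h : ∀ k, f k ≠ 0 → 0 ≤ k ∧ k < a ∧ 0 ≤ e.symm k ∧ e.symm k < b) :
    ∑ k ∈ range a, f k = ∑ k ∈ range b, f (e k) := by
  have aux : ∀ (g : ℤ → A) (c : ℕ), (∀ k, g k ≠ 0 → 0 ≤ k ∧ k < c) →
      ∑ k ∈ range c, g k = ∑ᶠ k, g k := by
    intro g c hg
    rw [finsum_eq_sum_of_support_subset (s := (range c).map Nat.castEmbedding) g ?_, sum_map]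
    · rfl
    · intro k hk
      obtain ⟨h1, h2⟩ := hg k hk
      simp only [coe_map, Set.mem_image, coe_range, Set.mem_Iio]
      exact ⟨k.toNat, by omega, by simp [h1]⟩
  rw [aux f a fun k hk => ⟨(h k hk).1, (h k hk).2.1⟩, aux (fun k => f (e k)) b, finsum_comp_equiv]
  intro k hk
  simpa using (h _ hk).2.2

theorem sum_Icc_neg_sub_pred {A : Type*} [AddCommGroup A] (V : ℤ → A) (R : ℕ) :
    ∑ p ∈ Icc (-(R : ℤ)) R, (V p - V (p - 1)) = V R - V (-R - 1) := by
  induction R with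
  | zero => simp
  | succ R ih =>
    have h : Icc (-((R + 1 : ℕ) : ℤ)) ((R + 1 : ℕ) : ℤ) =
        insert (-((R : ℤ) + 1)) (insert ((R : ℤ) + 1) (Icc (-(R : ℤ)) R)) := by
      ext p; simp only [mem_Icc, mem_insert]; push_cast; omega
    rw [h, sum_insert (by simp; omega), sum_insert (by simp), ih]
    push_cast
    rw [add_sub_cancel_right, show -((R : ℤ) + 1) = -R - 1 by ring]
    abel

section BoundedPentagonal

variable {F : Type*} [Field F] {q : F}

/-- The summand of the bounded pentagonal number sum `sum_pentTerm`. -/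
def pentTerm (q : F) (N u p : ℤ) : F :=
  (-1) ^ p * q ^ (p * (3 * p - 1) / 2) * qbinom q ((N - p - 1) / 2) (u + p - 1) *
    qbinom q ((N + p) / 2) (u - p)

theorem pentTerm_eq_zero {N u p : ℤ} (h : p < 1 - u ∨ u < p) : pentTerm q N u p = 0 := by
  rcases h with h | h
  · simp [pentTerm, qbinom_of_neg _ (by omega : u + p - 1 < 0)]
  · simp [pentTerm, qbinom_of_neg _ (by omega : u - p < 0)]

/-- The telescoping certificate for the recurrence of `pentTerm`. -/
def pentCert (q : F) (N u p : ℤ) : F :=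
  if 2 ∣ N - p then
    (-1) ^ p * q ^ (p * (3 * p - 1) / 2 + p + (N + p) / 2 - u) *
      qbinom q ((N - p) / 2 - 2) (u + p - 1) * qbinom q ((N + p) / 2 - 1) (u - p - 1)
  else 0

theorem pentTerm_recurrence (h0 : q ≠ 0) (hq : ∀ k : ℤ, k ≠ 0 → q ^ k ≠ 1) (N u p : ℤ) :
    pentTerm q N u p - pentTerm q (N - 1) u p - q ^ (N - 2 * u) * pentTerm q (N - 2) (u - 1) p =
      pentCert q N u p - pentCert q N u (p - 1) := by
  by_cases h : 2 ∣ N - p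
  · obtain ⟨A, hA⟩ := h
    obtain rfl : N = 2 * A + p := by omega
    have h1 := qbinom_succ_left h0 hq (A + p - 1) (u - p)
    have h2 := qbinom_succ_left h0 hq (A - 2) (u + p - 1)
    have e1 : q ^ (p * (3 * p - 1) / 2 + p + (A + p) - u) =
        q ^ (p * (3 * p - 1) / 2) * q ^ (A + p - (u - p)) := by
      rw [← zpow_add₀ h0]; congr 1; ring
    have e2 : q ^ (2 * A + p - 2 * u) = q ^ (A + p - (u - p)) * q ^ (A - (u + p)) := by
      rw [← zpow_add₀ h0]; congr 1; ring
    simp only [pentTerm, pentCert]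
    rw [if_pos (by omega), if_neg (by omega),
      show (2 * A + p - p - 1) / 2 = A - 1 by omega, show (2 * A + p + p) / 2 = A + p by omega,
      show (2 * A + p - 1 - p - 1) / 2 = A - 1 by omega,
      show (2 * A + p - 1 + p) / 2 = A + p - 1 by omega,
      show (2 * A + p - 2 - p - 1) / 2 = A - 2 by omega,
      show (2 * A + p - 2 + p) / 2 = A + p - 1 by omega,
      show (2 * A + p - p) / 2 = A by omega, e1, e2]
    rw [show A + p - 1 + 1 = A + p by ring] at h1
    rw [show A - 2 + 1 = A - 1 by ring, show A - 1 - (u + p - 1) = A - (u + p) by ring,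
      show u + p - 1 - 1 = u - 1 + p - 1 by ring] at h2
    rw [show u - 1 - p = u - p - 1 by ring, h1, h2]
    ring
  · obtain ⟨A, hA⟩ : 2 ∣ N - (p - 1) := by omega
    obtain rfl : N = 2 * A + p - 1 := by omega
    have h1 := qbinom_succ_left h0 hq (A + p - 2) (u - p)
    have h2 := qbinom_succ_left h0 hq (A - 2) (u + p - 1)
    have e1 : q ^ ((p - 1) * (3 * (p - 1) - 1) / 2 + (p - 1) + (A + p - 1) - u) =
        q ^ (p * (3 * p - 1) / 2) * q ^ (A - (u + p)) := by
      rw [← zpow_add₀ h0]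
      congr 1
      have : (p - 1) * (3 * (p - 1) - 1) = p * (3 * p - 1) + 2 * (2 - 3 * p) := by ring
      rw [this, Int.add_mul_ediv_left _ _ two_ne_zero]
      ring
    have e2 : q ^ (2 * A + p - 1 - 2 * u) = q ^ (A + p - 1 - (u - p)) * q ^ (A - (u + p)) := by
      rw [← zpow_add₀ h0]; congr 1; ring
    have e3 : (-1 : F) ^ (p - 1) = -(-1) ^ p := by
      rw [zpow_sub_one₀ (by simp)]; simp
    simp only [pentTerm, pentCert]
    rw [if_neg (by omega), if_pos (by omega),
      show (2 * A + p - 1 - p - 1) / 2 = A - 1 by omega,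
      show (2 * A + p - 1 + p) / 2 = A + p - 1 by omega,
      show (2 * A + p - 1 - 1 - p - 1) / 2 = A - 2 by omega,
      show (2 * A + p - 1 - 1 + p) / 2 = A + p - 1 by omega,
      show (2 * A + p - 1 - 2 - p - 1) / 2 = A - 2 by omega,
      show (2 * A + p - 1 - 2 + p) / 2 = A + p - 2 by omega,
      show (2 * A + p - 1 - (p - 1)) / 2 = A by omega,
      show (2 * A + p - 1 + (p - 1)) / 2 = A + p - 1 by omega, e1, e2, e3]
    rw [show A + p - 2 + 1 = A + p - 1 by ring] at h1
    rw [show A - 2 + 1 = A - 1 by ring, show A - 1 - (u + p - 1) = A - (u + p) by ring,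
      show u + p - 1 - 1 = u - 1 + p - 1 by ring] at h2
    rw [show u - 1 - p = u - p - 1 by ring, show u - (p - 1) - 1 = u - p by ring,
      show u + (p - 1) - 1 = u - 1 + p - 1 by ring, show A + p - 1 - 1 = A + p - 2 by ring, h1, h2]
    ring

theorem pentTerm_base_eq_zero {u p : ℤ} (hu : 1 ≤ u) (h : 2 ≤ u ∨ p ≠ 0) :
    pentTerm q (u + 1) u p = 0 := by
  by_cases hp : p < 1 - u ∨ u < p
  · exact pentTerm_eq_zero hp
  by_cases h1 : (u + 1 - p - 1) / 2 < u + p - 1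
  · rw [pentTerm, qbinom_eq_zero (by omega) h1, mul_zero, zero_mul]
  · rw [pentTerm, qbinom_eq_zero (n := (u + 1 + p) / 2) (by omega) (by omega), mul_zero]

theorem sum_pentTerm (h0 : q ≠ 0) (hq : ∀ k : ℤ, k ≠ 0 → q ^ k ≠ 1) {u R : ℕ} (hR : u ≤ R)
    {N : ℤ} (hN : u + 1 ≤ N) :
    ∑ p ∈ Icc (-(R : ℤ)) R, pentTerm q N u p = qbinom q (N - u - 1) (u - 1) := by
  induction u generalizing N with
  | zero =>
    rw [qbinom_of_neg _ (by simp)]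
    exact sum_eq_zero fun p _ => pentTerm_eq_zero (by push_cast; omega)
  | succ u ihu =>
    induction N, hN using Int.leInduction with
    | base =>
      rcases Nat.eq_zero_or_pos u with rfl | hu
      · rw [sum_eq_single 0]
        · simp [pentTerm, qbinom]
          simpa using one_sub_zpow_ne_zero hq one_ne_zero
        · exact fun p _ hp => pentTerm_base_eq_zero (by simp) (Or.inr hp)
        · simp
      · rw [qbinom_eq_zero (by push_cast; omega) (by push_cast; omega)]
        exact sum_eq_zero fun p _ => pentTerm_base_eq_zero (by push_cast; omega)
          (Or.inl (by push_cast; omega))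
    | succ N hN ih =>
      have h1 := sum_Icc_neg_sub_pred (pentCert q (N + 1) ((u + 1 : ℕ) : ℤ)) R
      have h2 : pentCert q (N + 1) ((u + 1 : ℕ) : ℤ) R = 0 := by
        simp only [pentCert, mul_zero, ite_self,
          qbinom_of_neg _ (by push_cast; omega : ((u + 1 : ℕ) : ℤ) - R - 1 < 0)]
      have h3 : pentCert q (N + 1) ((u + 1 : ℕ) : ℤ) (-R - 1) = 0 := by
        simp only [pentCert, mul_zero, zero_mul, ite_self,
          qbinom_of_neg _ (by push_cast; omega : ((u + 1 : ℕ) : ℤ) + (-R - 1) - 1 < 0)]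
      simp only [← pentTerm_recurrence h0 hq, h2, h3, sum_sub_distrib, ← mul_sum, sub_self,
        add_sub_cancel_right] at h1
      have ih2 := ihu (by omega) (N := N - 1) (by push_cast at hN; omega)
      have h4 := qbinom_succ_left h0 hq (N - u - 2) u
      push_cast at h1 ih ⊢
      rw [ih, add_sub_cancel_right, show N + 1 - 2 = N - 1 by ring, ih2] at h1
      rw [show N + 1 - ((u : ℤ) + 1) - 1 = N - u - 2 + 1 by ring, add_sub_cancel_right, h4]
      rw [show N - 1 - (u : ℤ) - 1 = N - u - 2 by ring,
        show N - ((u : ℤ) + 1) - 1 = N - u - 2 by ring,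
        show N + 1 - 2 * ((u : ℤ) + 1) = N - u - 2 + 1 - u by ring] at h1
      linear_combination h1

end BoundedPentagonal

section CrossTerm

variable {F : Type*} [Field F] {q : F}

/-- The exponent of `q` in `crossTerm`. -/
def crossExp (u A B : ℤ) : ℤ :=
  2 * A ^ 2 + 2 * B ^ 2 - 2 * A * B + (B - A) - u * (A + B) + u ^ 2

/-- The coefficient of `qbinom q (M + u) N` in `srTerm`. -/
def crossTerm (q : F) (N u p : ℤ) : F :=
  if 2 ∣ N - p then
    q ^ crossExp u ((N - p) / 2) ((N + p) / 2) * qbinom q ((N - p) / 2) (u + p) *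
      qbinom q ((N + p) / 2) (u - p)
  else
    -(q ^ crossExp u ((N - p + 1) / 2) ((N + p - 1) / 2) *
      qbinom q ((N + p + 1) / 2) (u - p + 1) * qbinom q ((N - p - 1) / 2) (u + p - 1))

/-- The telescoping certificate relating `crossTerm` to `pentTerm`. -/
def crossCert (q : F) (N u p : ℤ) : F :=
  if 2 ∣ N - p then
    q ^ crossExp u ((N - p) / 2) ((N + p) / 2) * qbinom q ((N - p) / 2 - 1) (u + p) *
      qbinom q ((N + p) / 2) (u - p)
  else 0

theorem crossTerm_sub_pentTerm (h0 : q ≠ 0) (hq : ∀ k : ℤ, k ≠ 0 → q ^ k ≠ 1) (N u p : ℤ) :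
    crossTerm q N u p -
        (-1) ^ N * q ^ (N * (N + 1) / 2 - u * N + u ^ 2 - u) * pentTerm q N u p =
      crossCert q N u p - crossCert q N u (p - 1) := by
  obtain ⟨c, hc⟩ := Int.even_mul_succ_self N
  obtain ⟨e, he⟩ : Even (p * (3 * p - 1)) := by
    rcases Int.even_or_odd p with h | h
    · exact h.mul_right _
    · exact Even.mul_left (by obtain ⟨k, rfl⟩ := h; exact ⟨3 * k + 1, by ring⟩) _
  simp only [pentTerm, show N * (N + 1) / 2 = c by omega, show p * (3 * p - 1) / 2 = e by omega]
  by_cases h : 2 ∣ N - p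
  · obtain ⟨A, hA⟩ := h
    obtain rfl : N = 2 * A + p := by omega
    have h1 := qbinom_succ_left h0 hq (A - 1) (u + p)
    have hs : (-1 : F) ^ (2 * A + p) * (-1) ^ p = 1 := by
      rw [← zpow_add₀ (by simp)]; exact Even.neg_one_zpow ⟨A + p, by ring⟩
    have e1 : q ^ crossExp u A (A + p) * q ^ (A - (u + p)) =
        q ^ (c - u * (2 * A + p) + u ^ 2 - u) * q ^ e := by
      rw [← zpow_add₀ h0, ← zpow_add₀ h0]
      congr 1
      simp only [crossExp]
      linarith
    simp only [crossTerm, crossCert]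
    rw [if_pos (by omega), if_pos (by omega), if_neg (by omega),
      show (2 * A + p - p - 1) / 2 = A - 1 by omega, show (2 * A + p + p) / 2 = A + p by omega,
      show (2 * A + p - p) / 2 = A by omega]
    rw [sub_add_cancel] at h1
    rw [h1]
    linear_combination qbinom q (A - 1) (u + p - 1) * qbinom q (A + p) (u - p) * e1 -
      q ^ (c - u * (2 * A + p) + u ^ 2 - u) * q ^ e * qbinom q (A - 1) (u + p - 1) *
      qbinom q (A + p) (u - p) * hs
  · obtain ⟨A, hA⟩ : 2 ∣ N - (p - 1) := by omega
    obtain rfl : N = 2 * A + p - 1 := by omega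
    have h1 := qbinom_succ_left h0 hq (A + p - 1) (u - p + 1)
    have hs : (-1 : F) ^ (2 * A + p - 1) * (-1) ^ p = -1 := by
      rw [← zpow_add₀ (by simp)]; exact Odd.neg_one_zpow ⟨A + p - 1, by ring⟩
    have e1 : q ^ crossExp u A (A + p - 1) * q ^ (A + p - (u - p + 1)) =
        q ^ (c - u * (2 * A + p - 1) + u ^ 2 - u) * q ^ e := by
      rw [← zpow_add₀ h0, ← zpow_add₀ h0]
      congr 1
      simp only [crossExp]
      linarith
    simp only [crossTerm, crossCert]
    rw [if_neg (by omega), if_neg (by omega), if_pos (by omega),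
      show (2 * A + p - 1 - p - 1) / 2 = A - 1 by omega,
      show (2 * A + p - 1 + p) / 2 = A + p - 1 by omega,
      show (2 * A + p - 1 - p + 1) / 2 = A by omega,
      show (2 * A + p - 1 + p - 1) / 2 = A + p - 1 by omega,
      show (2 * A + p - 1 + p + 1) / 2 = A + p by omega,
      show (2 * A + p - 1 - (p - 1)) / 2 = A by omega,
      show (2 * A + p - 1 + (p - 1)) / 2 = A + p - 1 by omega]
    rw [sub_add_cancel, add_sub_cancel_right] at h1
    rw [h1, show u + (p - 1) = u + p - 1 by ring, show u - (p - 1) = u - p + 1 by ring]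
    linear_combination -qbinom q (A - 1) (u + p - 1) * qbinom q (A + p - 1) (u - p) * e1 -
      q ^ (c - u * (2 * A + p - 1) + u ^ 2 - u) * q ^ e * qbinom q (A - 1) (u + p - 1) *
      qbinom q (A + p - 1) (u - p) * hs

theorem sum_crossTerm (h0 : q ≠ 0) (hq : ∀ k : ℤ, k ≠ 0 → q ^ k ≠ 1) {u R : ℕ} (hR : u < R)
    {N : ℤ} (hN : 1 ≤ N) (hu : 2 * u ≤ N) :
    ∑ p ∈ Icc (-(R : ℤ)) R, crossTerm q N u p =
      q ^ ((u : ℤ) ^ 2 + N * (N - 2 * u)) * qbinom q (-u) (N - 2 * u) := by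
  have h1 := sum_Icc_neg_sub_pred (crossCert q N u) R
  have h2 : crossCert q N u R = 0 := by
    simp [crossCert, qbinom_of_neg _ (by omega : (u : ℤ) - R < 0)]
  have h3 : crossCert q N u (-R - 1) = 0 := by
    simp [crossCert, qbinom_of_neg _ (by omega : (u : ℤ) + (-R - 1) < 0)]
  simp only [← crossTerm_sub_pentTerm h0 hq, h2, h3, sum_sub_distrib, ← mul_sum, sub_self,
    sum_pentTerm h0 hq hR.le (by omega : (u : ℤ) + 1 ≤ N)] at h1
  rw [sub_eq_zero.1 h1, qbinom_neg h0 hq, qbinom_symm h0 hq (by omega : 0 ≤ N - u - 1)]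
  obtain ⟨c, hc⟩ := Int.even_mul_succ_self N
  have hc' : (N - 2 * u) * (N - 2 * u - 1) = 2 * (c - N - 2 * u * N + 2 * u ^ 2 + u) := by
    linear_combination hc
  have hs : (-1 : F) ^ (N - 2 * u) = (-1) ^ N := by
    rw [zpow_sub₀ (by simp), Even.neg_one_zpow (n := 2 * (u : ℤ)) (by simp), div_one]
  rw [hc', Int.mul_ediv_cancel_left _ two_ne_zero, show N * (N + 1) / 2 = c by omega, hs,
    show (u : ℤ) + (N - 2 * u) - 1 = N - u - 1 by ring,
    show N - u - 1 - ((u : ℤ) - 1) = N - 2 * u by ring,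
    show c - u * N + (u : ℤ) ^ 2 - u = (u : ℤ) ^ 2 + N * (N - 2 * u) +
      (-(u * (N - 2 * u)) - (c - N - 2 * u * N + 2 * (u : ℤ) ^ 2 + u)) by linear_combination -hc,
    zpow_add₀ h0]
  ring

end CrossTerm

theorem tq_ne_zero : tq ≠ 0 := RatFunc.X_ne_zero

theorem tq_zpow_ne_one (k : ℤ) (hk : k ≠ 0) : tq ^ k ≠ 1 := by
  have key : ∀ n : ℕ, n ≠ 0 → tq ^ n ≠ 1 := by
    intro n hn h
    rw [tq, ← RatFunc.algebraMap_X, ← map_pow,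
      ← map_one (algebraMap (Polynomial ℚ) (RatFunc ℚ))] at h
    have h1 := congrArg Polynomial.natDegree (RatFunc.algebraMap_injective ℚ h)
    simp [hn] at h1
  rcases Int.natAbs_eq k with h | h <;> rw [h]
  · rw [zpow_natCast]; exact key _ (by omega)
  · rw [zpow_neg, zpow_natCast]; exact inv_ne_one.2 (key _ (by omega))

theorem gb_eq_qbinom (p : K) {n : ℤ} (hn : 0 ≤ n) (k : ℤ) : gb p n k = qbinom p n k := by
  rcases lt_or_ge k 0 with hk | hk
  · rw [qbinom_of_neg _ hk, gb, if_neg (by omega)]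
  rcases lt_or_ge n k with hkn | hkn
  · rw [qbinom_eq_zero hn hkn, gb, if_neg (by omega)]
  · rw [gb, qbinom, if_pos ⟨hk, hkn⟩, if_pos hk, prod_div_distrib, prod_div_distrib,
      ← prod_range_reflect (fun j : ℕ => 1 - p ^ (n - (j : ℤ)))]
    congr 1
    refine prod_congr rfl fun j hj => ?_
    rw [mem_range] at hj
    congr 2
    omega

theorem mem_of_gb_ne_zero {p : K} {n k : ℤ} (h : gb p n k ≠ 0) : 0 ≤ k ∧ k ≤ n := by
  by_contra hc
  exact h (if_neg hc)

theorem mem_of_qbinom_ne_zero {F : Type*} [Field F] {q : F} {n k : ℤ} (hn : 0 ≤ n)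
    (h : qbinom q n k ≠ 0) : 0 ≤ k ∧ k ≤ n := by
  by_contra hc
  rcases lt_or_ge k 0 with hk | hk
  · exact h (qbinom_of_neg _ hk)
  · exact h (qbinom_eq_zero hn (by omega))

theorem gb_mul_gb_eq_sum {q : K} (h0 : q ≠ 0) (hq : ∀ k : ℤ, k ≠ 0 → q ^ k ≠ 1) (M N : ℕ)
    {α A B : ℤ} (hN : A + B = N) (hA : 0 ≤ A ∨ N < 2 * α) (hB : 0 ≤ B ∨ N < -(2 * α)) :
    gb q (M - α) (A - 2 * α) * gb q (M + α) (B + 2 * α) =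
      ∑ u ∈ range (N / 2 + 1), qbinom q (M + u) N *
        (q ^ ((B + α - u) * (A - α - u)) * qbinom q A (u + α) * qbinom q B (u - α)) := by
  by_cases hpos : 0 ≤ A ∧ 0 ≤ B ∧ 0 ≤ A - 2 * α ∧ 0 ≤ B + 2 * α
  · obtain ⟨hA, hB, hk, hl⟩ := hpos
    have hgen : gb q (M - α) (A - 2 * α) * gb q (M + α) (B + 2 * α) =
        qbinom q (M - α) (A - 2 * α) * qbinom q (M + α) (B + 2 * α) := by
      rcases lt_or_ge ((M : ℤ) - α) 0 with h1 | h1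
      · rw [gb, if_neg (by omega), qbinom_eq_zero (n := M + α) (by omega) (by omega)]
        ring
      rcases lt_or_ge ((M : ℤ) + α) 0 with h2 | h2
      · rw [gb.eq_def q (M + α), if_neg (by omega),
          qbinom_eq_zero (n := M - α) (by omega) (by omega)]
        ring
      rw [gb_eq_qbinom _ h1, gb_eq_qbinom _ h2]
    obtain ⟨l, hl'⟩ := Int.eq_ofNat_of_zero_le hl
    have hg := qbinom_mul_qbinom h0 hq (M - α) (2 * α) hk l
    rw [show (M : ℤ) - α + 2 * α = M + α by ring] at hg
    rw [hgen, hl', hg, sum_range_comp_equiv (Equiv.addRight α)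
      (fun k => gouldCoeff q (2 * α) (A - 2 * α) l k * qbinom q (M - α + k) (A - 2 * α + l))
      (l + 1) (N / 2 + 1)]
    · refine sum_congr rfl fun u _ => ?_
      simp only [Equiv.coe_addRight, gouldCoeff]
      rw [← hl', show A - 2 * α + 2 * α = A by ring, show B + 2 * α - 2 * α = B by ring,
        qbinom_symm h0 hq hB, show B - (B + 2 * α - (u + α)) = u - α by ring,
        show A - 2 * α + (B + 2 * α) = N by linarith, show (M : ℤ) - α + (u + α) = M + u by ring,
        show B + 2 * α - (u + α) = B + α - u by ring, show A - (u + α) = A - α - u by ring]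
      ring
    · intro k hk
      simp only [gouldCoeff, ← hl', show A - 2 * α + 2 * α = A by ring,
        show B + 2 * α - 2 * α = B by ring, mul_ne_zero_iff] at hk
      have h1 := mem_of_qbinom_ne_zero hA hk.1.1.2
      have h2 := mem_of_qbinom_ne_zero hB hk.1.2
      simp only [Equiv.addRight_symm, Equiv.coe_addRight]
      omega
  · have h1 : gb q (M - α) (A - 2 * α) * gb q (M + α) (B + 2 * α) = 0 := by
      by_contra h
      have h1 := mem_of_gb_ne_zero (left_ne_zero_of_mul h)
      have h2 := mem_of_gb_ne_zero (right_ne_zero_of_mul h)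
      omega
    rw [h1, eq_comm]
    refine sum_eq_zero fun u hu => ?_
    by_contra h
    simp only [mul_ne_zero_iff] at h
    have hu : u < N / 2 + 1 := mem_range.1 hu
    have h2 : 0 ≤ u + α := not_lt.1 fun hc => h.2.1.2 (qbinom_of_neg _ hc)
    have h3 : 0 ≤ u - α := not_lt.1 fun hc => h.2.2 (qbinom_of_neg _ hc)
    have h4 : 0 ≤ A := by omega
    have h5 : 0 ≤ B := by omega
    have h6 := mem_of_qbinom_ne_zero h4 h.2.1.2
    have h7 := mem_of_qbinom_ne_zero h5 h.2.2
    omega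

/-- The summand of `Sr` without its first Gaussian binomial coefficient, for the summation index
`k` and the alternating index `j`. -/
def srTerm (q : K) (M : ℕ) (j k : ℤ) : K :=
  (-1) ^ j * q ^ ((j * (5 * j + 1)) / 2) *
    (q ^ (k * (k + (5 * j + 1) / 2)) * gb q (M - (5 * j + 1) / 2 + 2 * j) k *
      gb q (M + (5 * j + 1) / 2 - 2 * j) (k + (5 * j + 1) / 2))

theorem mem_of_srTerm_ne_zero {q : K} {M : ℕ} {j k : ℤ} (h : srTerm q M j k ≠ 0) :
    (0 ≤ k ∧ 0 ≤ k + (5 * j + 1) / 2) ∧ -(M : ℤ) ≤ j ∧ j ≤ M := by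
  have h1 := mem_of_gb_ne_zero (right_ne_zero_of_mul (right_ne_zero_of_mul h))
  have h2 := mem_of_gb_ne_zero
    (right_ne_zero_of_mul (left_ne_zero_of_mul (right_ne_zero_of_mul h)))
  omega

/-- The bijection from `ℤ` to the integers `j` for which `(5 * j + 1) / 2` has the parity
of `N`. -/
def altIndex (N p : ℤ) : ℤ := if 2 ∣ N - p then 2 * p else 1 - 2 * p

theorem srTerm_eq_sum {q : K} (h0 : q ≠ 0) (hq : ∀ k : ℤ, k ≠ 0 → q ^ k ≠ 1) (M : ℕ) {N : ℕ}
    (hN : 1 ≤ N) (p : ℤ) :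
    srTerm q M (altIndex N p) ((N - (5 * altIndex N p + 1) / 2) / 2) =
      ∑ u ∈ range (N / 2 + 1), qbinom q (M + u) N * crossTerm q N u p := by
  by_cases h : (2 : ℤ) ∣ N - p
  · obtain ⟨A, hA⟩ := id h
    have hs : (-1 : K) ^ (2 * p) = 1 := Even.neg_one_zpow (by simp)
    simp only [altIndex, crossTerm, if_pos h, srTerm, hs]
    rw [show (5 * (2 * p) + 1) / 2 = 5 * p by omega,
      show (N - 5 * p) / 2 = A - 2 * p by omega,
      show (N - p) / 2 = A by omega, show (N + p) / 2 = A + p by omega,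
      show (M : ℤ) - 5 * p + 2 * (2 * p) = M - p by ring,
      show (M : ℤ) + 5 * p - 2 * (2 * p) = M + p by ring,
      show A - 2 * p + 5 * p = A + p + 2 * p by ring,
      show 2 * p * (5 * (2 * p) + 1) = 2 * (p * (10 * p + 1)) by ring,
      Int.mul_ediv_cancel_left _ two_ne_zero, mul_assoc (q ^ ((A - 2 * p) * _)),
      gb_mul_gb_eq_sum h0 hq M N (by omega) (by omega) (by omega), mul_sum, mul_sum]
    refine sum_congr rfl fun u _ => ?_
    have e : q ^ crossExp u A (A + p) = q ^ (p * (10 * p + 1)) *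
        q ^ ((A - 2 * p) * (A + p + 2 * p)) * q ^ ((A + p + p - u) * (A - p - u)) := by
      rw [← zpow_add₀ h0, ← zpow_add₀ h0]
      congr 1
      simp only [crossExp]
      ring
    rw [e]
    ring
  · obtain ⟨A, hA⟩ : (2 : ℤ) ∣ N - (p - 1) := by omega
    have hs : (-1 : K) ^ (1 - 2 * p) = -1 := Odd.neg_one_zpow ⟨-p, by ring⟩
    simp only [altIndex, crossTerm, if_neg h, srTerm, hs]
    rw [show (5 * (1 - 2 * p) + 1) / 2 = 3 - 5 * p by omega,
      show (N - (3 - 5 * p)) / 2 = A + p - 2 * (1 - p) by omega,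
      show (N - p + 1) / 2 = A by omega, show (N + p - 1) / 2 = A + p - 1 by omega,
      show (N + p + 1) / 2 = A + p by omega, show (N - p - 1) / 2 = A - 1 by omega,
      show (M : ℤ) - (3 - 5 * p) + 2 * (1 - 2 * p) = M - (1 - p) by ring,
      show (M : ℤ) + (3 - 5 * p) - 2 * (1 - 2 * p) = M + (1 - p) by ring,
      show A + p - 2 * (1 - p) + (3 - 5 * p) = A - 1 + 2 * (1 - p) by ring,
      show (1 - 2 * p) * (5 * (1 - 2 * p) + 1) = 2 * ((1 - 2 * p) * (3 - 5 * p)) by ring,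
      Int.mul_ediv_cancel_left _ two_ne_zero, mul_assoc (q ^ ((A + p - 2 * (1 - p)) * _)),
      gb_mul_gb_eq_sum h0 hq M N (by omega) (by omega) (by omega), mul_sum, mul_sum]
    refine sum_congr rfl fun u _ => ?_
    have e : q ^ crossExp u A (A + p - 1) = q ^ ((1 - 2 * p) * (3 - 5 * p)) *
        q ^ ((A + p - 2 * (1 - p)) * (A - 1 + 2 * (1 - p))) *
        q ^ ((A - 1 + (1 - p) - u) * (A + p - (1 - p) - u)) := by
      rw [← zpow_add₀ h0, ← zpow_add₀ h0]
      congr 1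
      simp only [crossExp]
      ring
    rw [e, show u + (1 - p) = u - p + 1 by ring, show u - (1 - p) = u + p - 1 by ring]
    ring

theorem sum_srTerm {q : K} (h0 : q ≠ 0) (hq : ∀ k : ℤ, k ≠ 0 → q ^ k ≠ 1) (M : ℕ) {N R : ℕ}
    (hR : N < R) :
    ∑ p ∈ Icc (-(R : ℤ)) R, srTerm q M (altIndex N p) ((N - (5 * altIndex N p + 1) / 2) / 2) =
      ∑ n ∈ range (M + 1), qbinom q (M + n) N *
        (q ^ ((n : ℤ) ^ 2 + N * (N - 2 * n)) * qbinom q (-n) (N - 2 * n)) := by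
  have hr : ∑ n ∈ range (M + 1), qbinom q (M + n) N *
        (q ^ ((n : ℤ) ^ 2 + N * (N - 2 * n)) * qbinom q (-n) (N - 2 * n)) =
      ∑ n ∈ range (N / 2 + 1), qbinom q (M + n) N *
        (q ^ ((n : ℤ) ^ 2 + N * (N - 2 * n)) * qbinom q (-n) (N - 2 * n)) := by
    refine sum_range_comp_equiv (Equiv.refl ℤ) (fun n : ℤ => qbinom q (M + n) N *
        (q ^ (n ^ 2 + N * (N - 2 * n)) * qbinom q (-n) (N - 2 * n))) _ _ fun k hk => ?_
    simp only [mul_ne_zero_iff] at hk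
    have h1 : 0 ≤ (N : ℤ) - 2 * k := not_lt.1 fun hc => hk.2.2 (qbinom_of_neg _ hc)
    have h2 : 0 ≤ k := by
      by_contra hc
      have := mem_of_qbinom_ne_zero (by omega) hk.2.2
      omega
    have h3 := mem_of_qbinom_ne_zero (by omega) hk.1
    simp only [Equiv.refl_symm, Equiv.refl_apply]
    omega
  rw [hr]
  rcases Nat.eq_zero_or_pos N with rfl | hN
  · rw [sum_eq_single 0]
    · simp [altIndex, srTerm, gb]
    · intro p _ hp
      by_contra h
      have h1 := mem_of_srTerm_ne_zero h
      unfold altIndex at h1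
      split_ifs at h1 <;> omega
    · simp
  · rw [sum_congr rfl fun p _ => srTerm_eq_sum h0 hq M hN p, sum_comm]
    refine sum_congr rfl fun u hu => ?_
    rw [mem_range] at hu
    rw [← mul_sum, sum_crossTerm h0 hq (by omega) (by omega) (by omega)]

theorem gb_mul_gb_eq_sum_qbinom_neg {q : K} (h0 : q ≠ 0) (hq : ∀ k : ℤ, k ≠ 0 → q ^ k ≠ 1)
    (L M : ℕ) {n : ℕ} (hn : n ≤ M) :
    q ^ ((n : ℤ) ^ 2) * gb q ((L : ℤ) + M - n) L * gb q ((L : ℤ) - n) n =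
      ∑ N ∈ range (L + 1), gb q ((L : ℤ) + M - N) M * (qbinom q (M + n) N *
        (q ^ ((n : ℤ) ^ 2 + N * (N - 2 * n)) * qbinom q (-n) (N - 2 * n))) := by
  rcases lt_or_ge L n with hL | hL
  · rw [gb.eq_def q (L - n), if_neg (by omega), mul_zero, eq_comm]
    refine sum_eq_zero fun N hN => ?_
    rw [mem_range] at hN
    rw [qbinom_of_neg _ (by omega : (N : ℤ) - 2 * n < 0)]
    ring
  · have hg := qbinom_mul_qbinom h0 hq ((L : ℤ) - n) M (Nat.cast_nonneg n) (M - n)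
    rw [gb_eq_qbinom _ (by omega), gb_eq_qbinom _ (by omega), qbinom_symm h0 hq (by omega),
      mul_assoc, mul_comm (qbinom _ _ _), show (L : ℤ) + M - n - L = (M - n : ℕ) by omega,
      show (L : ℤ) + M - n = L - n + M by ring, hg, mul_sum,
      sum_range_comp_equiv (Equiv.subLeft ((n : ℤ) + M))
        (fun s => q ^ ((n : ℤ) ^ 2) * (gouldCoeff q M n (M - n : ℕ) s *
          qbinom q (L - n + s) (n + (M - n : ℕ)))) _ (L + 1)]
    · refine sum_congr rfl fun N hN => ?_
      rw [mem_range] at hN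
      simp only [Equiv.subLeft_apply, gouldCoeff]
      rw [gb_eq_qbinom _ (by omega), Nat.cast_sub hn, zpow_add₀ h0,
        qbinom_symm h0 hq (by omega : 0 ≤ (M : ℤ) + n) N,
        show (M : ℤ) - n - (n + M - N) = N - 2 * n by ring,
        show (n : ℤ) + M - (n + M - N) = N by ring,
        show (M : ℤ) - n - M = -n by ring,
        show (L : ℤ) - n + (n + M - N) = L + M - N by ring,
        show (n : ℤ) + (M - n) = M by ring,
        show (n : ℤ) + M = M + n by ring, mul_comm (N : ℤ)]
      ring
    · intro s hs
      simp only [gouldCoeff, mul_ne_zero_iff] at hs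
      have h1 := mem_of_qbinom_ne_zero (by omega) hs.2.1.1.2
      have h2 : 0 ≤ ((M - n : ℕ) : ℤ) - s := not_lt.1 fun hc => hs.2.1.2 (qbinom_of_neg _ hc)
      have h3 := mem_of_qbinom_ne_zero (by omega) hs.2.2
      simp only [Equiv.subLeft_symm_apply]
      omega

theorem sum_Sr_eq (q : K) (L M : ℕ) :
    ∑ j ∈ Icc (-(M : ℤ)) M,
      (-1 : K) ^ j * q ^ ((j * (5 * j + 1)) / 2) * Sr q L M ((5 * j + 1).fdiv 2) (2 * j) =
      ∑ N ∈ range (L + 1), gb q ((L : ℤ) + M - N) M *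
        ∑ p ∈ Icc (-((L + M + 1 : ℕ) : ℤ)) (L + M + 1 : ℕ),
          srTerm q M (altIndex N p) ((N - (5 * altIndex N p + 1) / 2) / 2) := by
  have h1 (j : ℤ) :
      (-1 : K) ^ j * q ^ ((j * (5 * j + 1)) / 2) * Sr q L M ((5 * j + 1).fdiv 2) (2 * j) =
        ∑ k ∈ range (L + 1),
          gb q ((L : ℤ) + M - (5 * j + 1) / 2 - 2 * k) M * srTerm q M j k := by
    rw [Int.fdiv_eq_ediv_of_nonneg _ zero_le_two, Sr, mul_sum, Int.toNat_natCast]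
    refine sum_congr rfl fun k _ => ?_
    rw [srTerm]
    ring
  simp only [h1, mul_sum]
  rw [← sum_product', ← sum_product']
  refine sum_bij_ne_zero
    (fun x _ _ => ((2 * x.2 + (5 * x.1 + 1) / 2 : ℤ).toNat,
      if 2 ∣ x.1 then x.1 / 2 else (1 - x.1) / 2)) ?_ ?_ ?_ ?_
  · rintro ⟨j, k⟩ hx hne
    have h3 := mem_of_srTerm_ne_zero (right_ne_zero_of_mul hne)
    have h4 := mem_of_gb_ne_zero (left_ne_zero_of_mul hne)
    simp only [mem_product, mem_range, mem_Icc] at hx h4 h3 ⊢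
    split_ifs <;> omega
  · rintro ⟨j, k⟩ hx hne ⟨j', k'⟩ hx' hne' he
    have h3 := mem_of_srTerm_ne_zero (right_ne_zero_of_mul hne)
    have h4 := mem_of_srTerm_ne_zero (right_ne_zero_of_mul hne')
    simp only [Prod.mk.injEq] at he h3 h4 ⊢
    obtain ⟨he1, he2⟩ := he
    split_ifs at he2 <;> omega
  · rintro ⟨N, p⟩ hx hne
    have h3 := mem_of_srTerm_ne_zero (right_ne_zero_of_mul hne)
    have h4 : 2 * ((N - (5 * altIndex N p + 1) / 2) / 2) + (5 * altIndex N p + 1) / 2 = N := by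
      unfold altIndex
      split_ifs <;> omega
    have h5 : (if 2 ∣ altIndex N p then altIndex N p / 2 else (1 - altIndex N p) / 2) = p := by
      unfold altIndex
      split_ifs <;> omega
    simp only [mem_product, mem_range, mem_Icc] at hx h3
    obtain ⟨k, hk⟩ := Int.eq_ofNat_of_zero_le h3.1.1
    rw [hk] at h3 h4
    refine ⟨(altIndex N p, k), ?_, ?_, ?_⟩
    · simp only [mem_product, mem_range, mem_Icc]
      omega
    · dsimp only at hne ⊢
      rwa [hk, show (L : ℤ) + M - N = L + M - (5 * altIndex N p + 1) / 2 - 2 * k by omega] at hne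
    · simp only [Prod.mk.injEq]
      exact ⟨by omega, h5⟩
  · rintro ⟨j, k⟩ hx hne
    have h3 := mem_of_srTerm_ne_zero (right_ne_zero_of_mul hne)
    dsimp only at h3 ⊢
    have h4 : altIndex ((2 * k + (5 * j + 1) / 2 : ℤ).toNat : ℤ)
        (if 2 ∣ j then j / 2 else (1 - j) / 2) = j := by
      unfold altIndex
      split_ifs <;> omega
    rw [h4, Int.toNat_of_nonneg (by omega)]
    congr 2 <;> omega

/-- Doubly bounded first Rogers–Ramanujan identity:
`Σ_{j∈ℤ} (-1)^j q^{j(5j+1)/2} S(L, M, ⌊(5j+1)/2⌋, 2j)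
= Σ_{n=0}^M q^{n²} [L+M-n choose L][L-n choose n]`
(terms with `|2j| > M` vanish). -/
theorem RR_doubly_bounded (L M : ℕ) :
    ∑ j ∈ Finset.Icc (-(M : ℤ)) M,
      (-1 : K) ^ j * tq ^ ((j * (5 * j + 1)) / 2) * Sr tq L M ((5 * j + 1).fdiv 2) (2 * j) =
      ∑ n ∈ Finset.range (M + 1),
        tq ^ ((n : ℤ) ^ 2) * gb tq ((L : ℤ) + M - n) L * gb tq ((L : ℤ) - n) n := by
  rw [sum_Sr_eq, sum_congr rfl fun n hn => gb_mul_gb_eq_sum_qbinom_neg tq_ne_zero tq_zpow_ne_one L M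
    (Nat.lt_succ_iff.1 (mem_range.1 hn)), sum_comm]
  refine sum_congr rfl fun N hN => ?_
  rw [mem_range] at hN
  rw [sum_srTerm tq_ne_zero tq_zpow_ne_one M (by omega), mul_sum]
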